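/- Let G be a graph of order n ≥ 3 with matching number m and vertex connectivity κ ≥ 2. If m ≤ κ, then G is Hamiltonian or G belongs to the family F of graphs H with K_{p,q} ⊆ H ⊆ K_p ∨ (q·K_1) for some q ≥ p+1 ≥ 3. -/

import Mathlib

open SimpleGraph Finset

/-- The matching number of a graph: the largest size of a matching. -/
noncomputable def matchingNumber {V : Type*} [Fintype V] (G : SimpleGraph V) : ℕ :=
  sSup {n | ∃ M : G.Subgraph, M.IsMatching ∧ M.edgeSet.ncard = n}

/-- The vertex connectivity of a finite graph: the least size of a set `S` of vertices
whose removal either disconnects the graph or leaves at most one vertex. -/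
noncomputable def vertexConnectivity {V : Type*} [Fintype V] (G : SimpleGraph V) : ℕ :=
  sInf {k | ∃ S : Finset V, S.card = k ∧
    (¬ (G.induce ((↑S : Set V)ᶜ)).Connected ∨ Fintype.card V ≤ k + 1)}

/-- `b` is the successor of `a` along the closed walk `c` (with its fixed orientation). -/
def IsCycleSucc {V : Type*} {G : SimpleGraph V} {v : V} (c : G.Walk v v) (a b : V) : Prop :=
  ∃ k < c.length, c.getVert k = a ∧ c.getVert (k + 1) = b

/-- The family `F` of graphs `H` with `K_{p,q} ⊆ H ⊆ K_p ∨ (q·K_1)` for some `q ≥ p + 1 ≥ 3`: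
the vertices split into a set `P` of size `p ≥ 2` and a set `Q` of size `q ≥ p + 1` such that
all `P`–`Q` edges are present and `Q` is independent. -/
def inFamilyF {V : Type*} [Fintype V] [DecidableEq V] (G : SimpleGraph V) : Prop :=
  ∃ P Q : Finset V, P ∪ Q = Finset.univ ∧ Disjoint P Q ∧
    Q.card ≥ P.card + 1 ∧ P.card ≥ 2 ∧
    (∀ a ∈ P, ∀ b ∈ Q, G.Adj a b) ∧
    (∀ a ∈ Q, ∀ b ∈ Q, ¬ G.Adj a b)

namespace SimpleGraph

variable {V : Type*} {G : SimpleGraph V}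

section Matching

/-- The number of edges is additive over vertex-disjoint subgraphs. -/
lemma Subgraph.ncard_edgeSet_sup_of_disjoint [Finite V] {M N : G.Subgraph}
    (hd : Disjoint M.verts N.verts) :
    (M ⊔ N).edgeSet.ncard = M.edgeSet.ncard + N.edgeSet.ncard := by
  rw [Subgraph.edgeSet_sup, Set.ncard_union_eq _ (Set.toFinite _) (Set.toFinite _)]
  rw [Set.disjoint_left]
  intro e
  induction e with
  | _ a b =>
    intro h h'
    exact Set.disjoint_left.1 hd (M.edge_vert h) (N.edge_vert h')

/-- A path on `k` vertices contains a matching with `k / 2` edges. -/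
lemma exists_isMatching_of_isChain [Finite V] :
    ∀ l : List V, l.Nodup → l.IsChain G.Adj →
      ∃ M : G.Subgraph, M.IsMatching ∧ M.verts ⊆ {x | x ∈ l} ∧ M.edgeSet.ncard = l.length / 2
  | [], _, _ => ⟨⊥, by simp [Subgraph.IsMatching], by simp, by simp⟩
  | [_], _, _ => ⟨⊥, by simp [Subgraph.IsMatching], by simp, by simp⟩
  | a :: b :: l, hn, hc => by
    have hab : G.Adj a b := hc.rel
    obtain ⟨M, hM, hv, hcard⟩ := exists_isMatching_of_isChain l (by grind) hc.of_cons.of_cons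
    have hd : Disjoint (G.subgraphOfAdj hab).verts M.verts := by
      rw [Set.disjoint_left]
      intro x hx hx'
      have := hv hx'
      simp at hx this
      grind
    refine ⟨G.subgraphOfAdj hab ⊔ M, (Subgraph.IsMatching.subgraphOfAdj hab).sup hM ?_, ?_, ?_⟩
    · rw [(Subgraph.IsMatching.subgraphOfAdj hab).support_eq_verts, hM.support_eq_verts]
      exact hd
    · intro x hx
      simp only [Subgraph.verts_sup, subgraphOfAdj_verts] at hx
      rcases hx with hx | hx
      · simp at hx ⊢; tauto
      · have := hv hx
        simp at this ⊢; tauto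
    · rw [Subgraph.ncard_edgeSet_sup_of_disjoint hd, hcard, edgeSet_subgraphOfAdj]
      simp; omega

/-- Two disjoint paths bound the matching number from below. -/
lemma le_matchingNumber_of_isChain [Fintype V] {l₁ l₂ : List V} (hn : (l₁ ++ l₂).Nodup)
    (h₁ : l₁.IsChain G.Adj) (h₂ : l₂.IsChain G.Adj) :
    l₁.length / 2 + l₂.length / 2 ≤ matchingNumber G := by
  rw [List.nodup_append'] at hn
  obtain ⟨M, hM, hMv, hMc⟩ := exists_isMatching_of_isChain l₁ hn.1 h₁
  obtain ⟨N, hN, hNv, hNc⟩ := exists_isMatching_of_isChain l₂ hn.2.1 h₂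
  have hd : Disjoint M.verts N.verts :=
    Set.disjoint_left.2 fun x hx hx' => hn.2.2 (hMv hx) (hNv hx')
  refine le_csSup ⟨Nat.card (Sym2 V), ?_⟩
    ⟨M ⊔ N, hM.sup hN (by rwa [hM.support_eq_verts, hN.support_eq_verts]), ?_⟩
  · rintro _ ⟨K, -, rfl⟩
    exact Set.ncard_le_card _
  · rw [Subgraph.ncard_edgeSet_sup_of_disjoint hd, hMc, hNc]

end Matching

section Connectivity

variable [Fintype V]

/-- The outer boundary of a vertex set which, together with its boundary, misses some vertex has
at least `κ` elements. -/
lemma vertexConnectivity_le_card_of_boundary {H : Set V} {S : Finset V}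
    (hS : ∀ h ∈ H, ∀ v ∉ H, G.Adj h v → v ∈ S) (hHS : ∀ h ∈ H, h ∉ S)
    {x c : V} (hx : x ∈ H) (hc : c ∉ H) (hcS : c ∉ S) :
    vertexConnectivity G ≤ S.card := by
  refine Nat.sInf_le ⟨S, rfl, Or.inl fun hconn => ?_⟩
  obtain ⟨p⟩ := hconn.preconnected ⟨x, by simpa using hHS x hx⟩ ⟨c, by simpa using hcS⟩
  have key : ∀ {a b : ((↑S : Set V)ᶜ : Set V)},
      (G.induce ((↑S : Set V)ᶜ)).Walk a b → a.1 ∈ H → b.1 ∈ H := by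
    intro a b q
    induction q with
    | nil => exact id
    | @cons u v w h q ih =>
      intro hu
      refine ih (by_contra fun hv => ?_)
      exact v.2 (by simpa using hS _ hu _ hv h)
  exact hc (key p hx)

/-- A vertex with a non-neighbour other than itself has at least `κ` neighbours. -/
lemma vertexConnectivity_le_card_of_adj_imp {S : Finset V} {v c : V} (hS : ∀ w, G.Adj v w → w ∈ S)
    (hv : v ∉ S) (hcv : c ≠ v) (hc : c ∉ S) : vertexConnectivity G ≤ S.card :=
  vertexConnectivity_le_card_of_boundary (H := {v}) (by simpa using fun w _ => hS w)
    (by simpa using hv) rfl (by simpa using hcv) hc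

end Connectivity

section CyclicList

/-- The list `l` traverses a cycle of `G`; the degenerate cases of no vertex and of the two ends
of an edge are allowed. -/
structure IsCyclicList (G : SimpleGraph V) (l : List V) : Prop where
  nodup : l.Nodup
  chain : Cycle.Chain G.Adj (l : Cycle V)

lemma isCyclicList_iff {l : List V} (hl : l ≠ []) :
    G.IsCyclicList l ↔ l.Nodup ∧ l.IsChain G.Adj ∧ G.Adj (l.getLast hl) (l.head hl) := by
  have : Cycle.Chain G.Adj (l : Cycle V) ↔
      l.IsChain G.Adj ∧ G.Adj (l.getLast hl) (l.head hl) := by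
    rw [Cycle.chain_ne_nil _ hl]
    cases l with
    | nil => simp at hl
    | cons a t => rw [List.isChain_cons_cons, and_comm]; rfl
  exact ⟨fun h => ⟨h.1, this.1 h.2⟩, fun h => ⟨h.1, this.2 h.2⟩⟩

lemma IsCyclicList.of_isRotated {l l' : List V} (h : G.IsCyclicList l) (hr : l ~r l') :
    G.IsCyclicList l' :=
  ⟨hr.nodup_iff.1 h.nodup, (Cycle.coe_eq_coe.2 hr) ▸ h.chain⟩

lemma IsCyclicList.isChain {l : List V} (h : G.IsCyclicList l) : l.IsChain G.Adj := by
  rcases eq_or_ne l [] with rfl | hl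
  · exact .nil
  · exact ((isCyclicList_iff hl).1 h).2.1

lemma IsCyclicList.exists_length_maximal [Fintype V] (G : SimpleGraph V) :
    ∃ l, G.IsCyclicList l ∧ ∀ l', G.IsCyclicList l' → l'.length ≤ l.length := by
  have hbdd : BddAbove {n | ∃ l, G.IsCyclicList l ∧ l.length = n} := by
    refine ⟨Fintype.card V, ?_⟩
    rintro _ ⟨l, hl, rfl⟩
    exact hl.nodup.length_le_card
  obtain ⟨l, hl, hlen⟩ := Nat.sSup_mem (s := {n | ∃ l, G.IsCyclicList l ∧ l.length = n})
    ⟨0, [], ⟨List.nodup_nil, Cycle.Chain.nil _⟩, rfl⟩ hbdd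
  exact ⟨l, hl, fun l' hl' => hlen ▸ le_csSup hbdd ⟨l', hl', rfl⟩⟩

variable [DecidableEq V]

/-- A cyclic list through all vertices is a Hamiltonian cycle. -/
lemma IsCyclicList.isHamiltonian [Fintype V] {l : List V} (h : G.IsCyclicList l)
    (hn : 3 ≤ Fintype.card V) (hl : ∀ v, v ∈ l) : G.IsHamiltonian := by
  have hlen : l.length = Fintype.card V := by
    rw [← List.toFinset_card_of_nodup h.nodup, ← Finset.card_univ]
    congr 1
    ext; simp [hl]
  have hne : l ≠ [] := by rintro rfl; simp at hlen; omega
  obtain ⟨-, hc, ha⟩ := (isCyclicList_iff hne).1 h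
  intro _
  let p : G.Walk (l.getLast hne) (l.getLast hne) := .cons ha (.ofSupport l hne hc)
  have hp : p.tail.support = l := by simp [p]
  have hpath : p.tail.IsPath := by rw [Walk.isPath_def, hp]; exact h.nodup
  refine ⟨_, p, ?_, hpath.isHamiltonian_of_mem (by simpa [hp] using hl)⟩
  refine Walk.isCycle_iff_isPath_tail_and_le_length.2 ⟨hpath, ?_⟩
  simp [p]; omega

lemma formPerm_apply_of_append {l u w : List V} {a b : V} (hn : l.Nodup)
    (h : l = u ++ a :: b :: w) : l.formPerm a = b := by
  have hr : l ~r (a :: b :: w) ++ u := h ▸ List.isRotated_append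
  rw [List.formPerm_eq_of_isRotated hn hr]
  exact List.formPerm_apply_head _ _ _ (hr.nodup_iff.1 hn)

/-- A list of at least two elements can be rotated to start with `x` and its successor. -/
lemma exists_isRotated_cons_formPerm {l : List V} (hn : l.Nodup) (h2 : 2 ≤ l.length) {x : V}
    (hx : x ∈ l) : ∃ t, l ~r x :: l.formPerm x :: t := by
  obtain ⟨u, w, rfl⟩ := List.append_of_mem hx
  have hr : u ++ x :: w ~r x :: w ++ u := List.isRotated_append
  have hlen := hr.perm.length_eq
  obtain ⟨b, t, hbt⟩ : ∃ b t, w ++ u = b :: t := by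
    cases hwu : w ++ u with
    | nil => simp at hwu; simp [hwu] at h2
    | cons b t => exact ⟨b, t, rfl⟩
  rw [List.cons_append, hbt] at hr
  refine ⟨t, ?_⟩
  rw [List.formPerm_eq_of_isRotated hn hr, List.formPerm_apply_head _ _ _ (hr.nodup_iff.1 hn)]
  exact hr

/-- A list of at least two elements can be rotated to end with `x` and start with its successor. -/
lemma exists_isRotated_formPerm_cons_concat {l : List V} (hn : l.Nodup) (h2 : 2 ≤ l.length) {x : V}
    (hx : x ∈ l) : ∃ t, l ~r l.formPerm x :: (t ++ [x]) := by
  obtain ⟨t, ht⟩ := exists_isRotated_cons_formPerm hn h2 hx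
  exact ⟨t, ht.trans (List.isRotated_append (l := [x]))⟩

lemma union_map_formPerm_subset {l : List V} {S : Finset V} (hS : S ⊆ l.toFinset) :
    S ∪ S.map l.formPerm.toEmbedding ⊆ l.toFinset := by
  refine Finset.union_subset hS fun a ha => ?_
  obtain ⟨b, hb, rfl⟩ := Finset.mem_map.1 ha
  simpa using List.formPerm_apply_mem_of_mem (List.mem_toFinset.1 (hS hb))

lemma card_union_map_formPerm {l : List V} {S : Finset V} (hσ : ∀ s ∈ S, l.formPerm s ∉ S) :
    (S ∪ S.map l.formPerm.toEmbedding).card = 2 * S.card := by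
  rw [Finset.card_union_of_disjoint, Finset.card_map, two_mul]
  rw [Finset.disjoint_left]
  intro a ha ha'
  obtain ⟨b, hb, rfl⟩ := Finset.mem_map.1 ha'
  exact hσ b hb ha

/-- A set of vertices of a cycle no two of which are consecutive is at most half of the cycle. -/
lemma two_mul_card_le_length {l : List V} (hn : l.Nodup) {S : Finset V} (hS : S ⊆ l.toFinset)
    (hσ : ∀ s ∈ S, l.formPerm s ∉ S) : 2 * S.card ≤ l.length := by
  rw [← card_union_map_formPerm hσ, ← List.toFinset_card_of_nodup hn]
  exact Finset.card_le_card (union_map_formPerm_subset hS)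

/-- If a set of pairwise non-consecutive vertices is half of the cycle, then every other vertex of
the cycle is the successor of one of its elements. -/
lemma exists_formPerm_eq_of_length_le {l : List V} (hn : l.Nodup) {S : Finset V}
    (hS : S ⊆ l.toFinset) (hσ : ∀ s ∈ S, l.formPerm s ∉ S) (hle : l.length ≤ 2 * S.card)
    {v : V} (hv : v ∈ l) (hvS : v ∉ S) : ∃ s ∈ S, l.formPerm s = v := by
  have heq := Finset.eq_of_subset_of_card_le (union_map_formPerm_subset hS)
    (by rwa [card_union_map_formPerm hσ, List.toFinset_card_of_nodup hn])
  rw [← List.mem_toFinset, ← heq, Finset.mem_union] at hv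
  simpa only [Finset.mem_map, Equiv.coe_toEmbedding] using hv.resolve_left hvS

/-- A longest cycle admits no path outside of it joining two consecutive vertices. -/
lemma IsCyclicList.not_exists_ear {l p : List V} (hl : G.IsCyclicList l)
    (hmax : ∀ l', G.IsCyclicList l' → l'.length ≤ l.length) (h2 : 2 ≤ l.length) {x : V}
    (hx : x ∈ l) (hp : p ≠ []) (hpn : p.Nodup) (hpc : p.IsChain G.Adj) (hpl : ∀ v ∈ p, v ∉ l)
    (hhead : G.Adj x (p.head hp)) : ¬ G.Adj (p.getLast hp) (l.formPerm x) := by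
  intro hlast
  obtain ⟨t, ht⟩ := exists_isRotated_formPerm_cons_concat hl.nodup h2 hx
  have hmem : ∀ v, v ∈ l ↔ v ∈ l.formPerm x :: (t ++ [x]) := fun v => ht.mem_iff
  have hlen := ht.perm.length_eq
  have hcyc := hl.of_isRotated ht
  generalize l.formPerm x = y at *
  have hnew : G.IsCyclicList ((y :: (t ++ [x])) ++ p) := by
    rw [isCyclicList_iff (by simp)]
    refine ⟨?_, ?_, ?_⟩
    · rw [List.nodup_append']
      exact ⟨hcyc.nodup, hpn, fun v hv hv' => hpl v hv' ((hmem v).2 hv)⟩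
    · rw [List.isChain_append]
      refine ⟨hcyc.isChain, hpc, ?_⟩
      intro a ha b hb
      rw [List.head?_eq_some_head hp] at hb
      simp [List.getLast?_cons] at ha hb
      subst ha hb
      exact hhead
    · simpa [List.getLast_append_of_ne_nil, hp] using hlast
  have := hmax _ hnew
  have := List.length_pos_iff.2 hp
  simp at *
  omega

/-- If a vertex outside a longest cycle is adjacent to two vertices of the cycle, then the
successors of these two vertices are not adjacent. -/
lemma IsCyclicList.not_adj_formPerm_formPerm {l : List V} (hl : G.IsCyclicList l)
    (hmax : ∀ l', G.IsCyclicList l' → l'.length ≤ l.length) (h2 : 2 ≤ l.length) {x b c : V}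
    (hx : x ∉ l) (hb : b ∈ l) (hc : c ∈ l) (hbc : c ≠ b) (hxb : G.Adj x b) (hxc : G.Adj x c) :
    ¬ G.Adj (l.formPerm b) (l.formPerm c) := by
  intro hadj
  obtain ⟨t, ht⟩ := exists_isRotated_formPerm_cons_concat hl.nodup h2 hb
  have hmem : ∀ v, v ∈ l ↔ v ∈ l.formPerm b :: (t ++ [b]) := fun v => ht.mem_iff
  have hlen := ht.perm.length_eq
  have hcyc := hl.of_isRotated ht
  obtain ⟨u, w, huw⟩ : ∃ u w, l.formPerm b :: t = u ++ c :: w :=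
    List.append_of_mem (by have := (hmem c).1 hc; simp at this ⊢; tauto)
  obtain ⟨d, w', hd⟩ : ∃ d w', w ++ [b] = d :: w' := by
    cases w <;> simp
  have hl' : l.formPerm b :: (t ++ [b]) = (u ++ [c]) ++ d :: w' := by
    rw [← List.cons_append, huw, List.append_assoc, List.cons_append, hd]; simp
  have hσ : l.formPerm c = d := by
    rw [List.formPerm_eq_of_isRotated hl.nodup ht]
    exact formPerm_apply_of_append hcyc.nodup (u := u) (w := w') (by simpa using hl')
  rw [hσ] at hadj
  have hhead : (u ++ [c]).head (by simp) = l.formPerm b := by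
    cases u <;> simp at huw ⊢ <;> exact huw.1.symm
  have hlast : (d :: w').getLast (by simp) = b := by
    simp [← hd]
  rw [hl'] at hcyc hlen
  have hmem' : ∀ v, v ∈ l ↔ v ∈ (u ++ [c]) ++ d :: w' := fun v => hl' ▸ hmem v
  obtain ⟨hn, hch, -⟩ := (isCyclicList_iff (by simp)).1 hcyc
  rw [List.isChain_append] at hch
  have hnew : G.IsCyclicList (x :: ((u ++ [c]).reverse ++ d :: w')) := by
    rw [isCyclicList_iff (by simp)]
    refine ⟨?_, ?_, ?_⟩
    · rw [List.nodup_cons]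
      refine ⟨fun h => hx ((hmem' x).2 (by simpa [or_comm, or_assoc, or_left_comm] using h)), ?_⟩
      exact (((List.reverse_perm _).append_right _).nodup_iff).2 hn
    · rw [List.isChain_cons, List.isChain_append, List.isChain_reverse]
      refine ⟨by simpa using hxc, ?_, hch.2.1, ?_⟩
      · exact hch.1.imp fun _ _ h => h.symm
      · rw [List.getLast?_reverse, List.head?_eq_some_head (by simp), hhead]
        simpa using hadj
    · rw [List.getLast_cons (by simp), List.getLast_append_of_ne_nil _ (by simp), hlast]
      exact hxb.symm
  have := hmax _ hnew
  simp at *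
  omega

/-- A longest cycle that misses a vertex has length at least `2κ`. -/
lemma IsCyclicList.two_mul_vertexConnectivity_le [Fintype V] {l : List V} (hl : G.IsCyclicList l)
    (hmax : ∀ l', G.IsCyclicList l' → l'.length ≤ l.length) (h2 : 2 ≤ l.length) {x : V}
    (hx : x ∉ l) : 2 * vertexConnectivity G ≤ l.length := by
  classical
  let T : Set V := {v | v ∉ l}
  let H : Set V := {v | ∃ hv : v ∈ T, (G.induce T).Reachable ⟨x, hx⟩ ⟨v, hv⟩}
  let S : Finset V := l.toFinset.filter fun c => ∃ h ∈ H, G.Adj h c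
  have hS : S ⊆ l.toFinset := Finset.filter_subset _ _
  have hσ : ∀ s ∈ S, l.formPerm s ∉ S := by
    intro s hs hs'
    obtain ⟨hsl, h, ⟨hh, hxh⟩, hadj⟩ := Finset.mem_filter.1 hs
    obtain ⟨-, h', ⟨hh', hxh'⟩, hadj'⟩ := Finset.mem_filter.1 hs'
    obtain ⟨p, hp⟩ := (hxh.symm.trans hxh').exists_isPath
    refine hl.not_exists_ear hmax h2 (List.mem_toFinset.1 hsl) (p := p.support.map Subtype.val)
      (mt List.map_eq_nil_iff.1 p.support_ne_nil) ?_ ?_ ?_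
      (by simpa only [List.head_map, Walk.head_support] using hadj.symm)
      (by simpa only [List.getLast_map, Walk.getLast_support] using hadj')
    · exact (Walk.isPath_def _ |>.1 hp).map Subtype.val_injective
    · rw [List.isChain_map]
      exact p.isChain_adj_support
    · intro v hv
      obtain ⟨w, -, rfl⟩ := List.mem_map.1 hv
      exact w.2
  have hcard := two_mul_card_le_length hl.nodup hS hσ
  obtain ⟨c, hc, hcS⟩ : ∃ c ∈ l, c ∉ S := by
    by_contra! hall
    obtain ⟨a, ha⟩ := List.exists_mem_of_length_pos (l := l) (by omega)
    exact hσ a (hall a ha) (hall _ (List.formPerm_apply_mem_of_mem ha))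
  have := vertexConnectivity_le_card_of_boundary (G := G) (H := H) (S := S) ?_ ?_
    (x := x) (c := c) ⟨hx, .refl _⟩ (fun h => h.1 hc) hcS
  · omega
  · rintro h ⟨hh, hxh⟩ v hv hadj
    refine Finset.mem_filter.2 ⟨?_, h, ⟨hh, hxh⟩, hadj⟩
    by_contra hvl
    rw [List.mem_toFinset] at hvl
    exact hv ⟨hvl, hxh.trans (Adj.reachable (G := G.induce T) hadj)⟩
  · rintro h ⟨hh, -⟩ hhS
    exact hh (List.mem_toFinset.1 (hS hhS))

end CyclicList

end SimpleGraph

/-- If a graph of order `n ≥ 3` has matching number at most its connectivity `κ ≥ 2`,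
then it is Hamiltonian or belongs to the family `F`. -/
theorem stmt_0 {V : Type*} [Fintype V] [DecidableEq V] (G : SimpleGraph V)
    (hn : 3 ≤ Fintype.card V)
    (hκ : 2 ≤ vertexConnectivity G)
    (hm : matchingNumber G ≤ vertexConnectivity G) :
    G.IsHamiltonian ∨ inFamilyF G := by
  classical
  obtain ⟨l, hl, hmax⟩ := IsCyclicList.exists_length_maximal G
  -- Some edge leaves every nonempty proper set of vertices.
  have hedge : ∀ H : Set V, ∀ x ∈ H, ∀ c ∉ H, ∃ h ∈ H, ∃ v ∉ H, G.Adj h v := by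
    intro H x hx c hc
    by_contra! hno
    have := vertexConnectivity_le_card_of_boundary (G := G) (H := H) (S := ∅)
      (fun h hh v hv hadj => absurd hadj (hno h hh v hv)) (by simp) hx hc (by simp)
    simp at this
    omega
  have h2 : 2 ≤ l.length := by
    obtain ⟨a, b, hab⟩ := Fintype.exists_pair_of_one_lt_card (α := V) (by omega)
    obtain ⟨u, -, v, -, huv⟩ := hedge {a} a rfl b (by simpa using hab.symm)
    refine hmax [u, v] ((isCyclicList_iff (by simp)).2 ⟨?_, ?_, ?_⟩)
    · simpa using huv.ne
    · simpa using huv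
    · simpa using huv.symm
  by_cases hall : ∀ v, v ∈ l
  · exact Or.inl (hl.isHamiltonian hn hall)
  right
  push Not at hall
  obtain ⟨x, hx⟩ := hall
  have hge := hl.two_mul_vertexConnectivity_le hmax h2 hx
  have hlen : l.length = 2 * vertexConnectivity G := by
    obtain ⟨a, ha⟩ := List.exists_mem_of_length_pos (l := l) (by omega)
    obtain ⟨h, hh, c, hc, hadj⟩ := hedge {v | v ∉ l} x hx a (by simpa using ha)
    simp only [Set.mem_ofPred_eq, not_not] at hh hc
    obtain ⟨t, ht⟩ := exists_isRotated_cons_formPerm hl.nodup h2 hc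
    have hcyc := hl.of_isRotated ht
    have hmem := ht.mem_iff (a := h)
    have := ht.perm.length_eq
    have := le_matchingNumber_of_isChain (G := G) (l₁ := [h, c]) (l₂ := l.formPerm c :: t)
      (List.nodup_cons.2 ⟨fun h' => hh (hmem.2 h'), hcyc.nodup⟩) (by simpa using hadj)
      hcyc.isChain.of_cons
    simp at *
    omega
  have houter : ∀ u ∉ l, ∀ v ∉ l, ¬ G.Adj u v := by
    intro u hu v hv hadj
    have := le_matchingNumber_of_isChain (G := G) (l₁ := [u, v]) (l₂ := l)
      (by simp [hu, hv, hl.nodup, hadj.ne]) (by simpa using hadj) hl.isChain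
    simp at this
    omega
  let P : Finset V := l.toFinset.filter fun c => G.Adj x c
  have hPl : P ⊆ l.toFinset := Finset.filter_subset _ _
  have hmemP : ∀ v, v ∈ P ↔ v ∈ l ∧ G.Adj x v := fun v => by simp [P]
  have hxP : x ∉ P := fun h => hx ((hmemP x).1 h).1
  have hσ : ∀ s ∈ P, l.formPerm s ∉ P := by
    intro s hs hs'
    rw [hmemP] at hs hs'
    exact hl.not_exists_ear hmax h2 hs.1 (p := [x]) (by simp) (by simp) (by simp)
      (by simpa using hx) (by simpa using hs.2.symm) (by simpa using hs'.2)
  have hPcard : P.card = vertexConnectivity G := by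
    have h₁ := two_mul_card_le_length hl.nodup hPl hσ
    obtain ⟨c, hc, hcP⟩ : ∃ c ∈ l, c ∉ P := by
      by_contra! hsub
      obtain ⟨a, ha⟩ := List.exists_mem_of_length_pos (l := l) (by omega)
      exact hσ a (hsub a ha) (hsub _ (List.formPerm_apply_mem_of_mem ha))
    have h₂ := vertexConnectivity_le_card_of_adj_imp (G := G) (S := P) (v := x) (c := c)
      (fun w hw => (hmemP w).2 ⟨by_contra fun hwl => houter x hx w hwl hw, hw⟩) hxP
      (fun h => hx (h ▸ hc)) hcP
    omega
  have hsucc : ∀ v ∈ l, v ∉ P → ∃ s ∈ P, l.formPerm s = v := fun v hv hvP =>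
    exists_formPerm_eq_of_length_le hl.nodup hPl hσ (by omega) hv hvP
  have hmixed : ∀ y ∉ l, ∀ s ∈ P, ¬ G.Adj y (l.formPerm s) := by
    intro y hy s hs hadj
    have hs' := (hmemP s).1 hs
    rcases eq_or_ne y x with rfl | hyx
    · exact hσ s hs ((hmemP _).2 ⟨List.formPerm_apply_mem_of_mem hs'.1, hadj⟩)
    obtain ⟨t, ht⟩ := exists_isRotated_cons_formPerm hl.nodup h2 hs'.1
    have hcyc := hl.of_isRotated ht
    have hmemx := ht.mem_iff (a := x)
    have hmemy := ht.mem_iff (a := y)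
    have := ht.perm.length_eq
    have hch := hcyc.isChain
    have := hcyc.nodup
    have := le_matchingNumber_of_isChain (G := G) (l₁ := [x, s, l.formPerm s, y]) (l₂ := t)
      (by simp at *; grind) (by simp [hs'.2, hadj.symm, hch.rel]) hch.of_cons.of_cons
    simp at *
    omega
  have hindep : ∀ a ∉ P, ∀ b ∉ P, ¬ G.Adj a b := by
    intro a ha b hb hadj
    by_cases hal : a ∈ l <;> by_cases hbl : b ∈ l
    · obtain ⟨s, hs, rfl⟩ := hsucc a hal ha
      obtain ⟨s', hs', rfl⟩ := hsucc b hbl hb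
      refine hl.not_adj_formPerm_formPerm hmax h2 hx ((hmemP s).1 hs).1 ((hmemP s').1 hs').1 ?_
        ((hmemP s).1 hs).2 ((hmemP s').1 hs').2 hadj
      rintro rfl
      exact hadj.ne rfl
    · obtain ⟨s, hs, rfl⟩ := hsucc a hal ha
      exact hmixed b hbl s hs hadj.symm
    · obtain ⟨s, hs, rfl⟩ := hsucc b hbl hb
      exact hmixed a hal s hs hadj
    · exact houter a hal b hbl hadj
  have hQcard : P.card + 1 ≤ Pᶜ.card := by
    rw [← Finset.card_map l.formPerm.toEmbedding, ← Finset.card_insert_of_notMem (a := x)]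
    · refine Finset.card_le_card fun v hv => ?_
      rw [Finset.mem_compl]
      rcases Finset.mem_insert.1 hv with rfl | hv
      · exact hxP
      · obtain ⟨s, hs, rfl⟩ := Finset.mem_map.1 hv
        exact hσ s hs
    · intro h
      exact hx (List.mem_toFinset.1
        (union_map_formPerm_subset hPl (Finset.mem_union_right _ h)))
  refine ⟨P, Pᶜ, Finset.union_compl P, disjoint_compl_right, hQcard, by omega, ?_, ?_⟩
  · intro a ha b hb
    obtain ⟨c, hc, hcb⟩ := Finset.exists_mem_ne (s := Pᶜ) (by omega) b
    rw [Finset.mem_compl] at hb hc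
    have hle := vertexConnectivity_le_card_of_adj_imp (G := G) (S := P.filter fun w => G.Adj b w)
      (v := b) (c := c)
      (fun w hw => Finset.mem_filter.2 ⟨by_contra fun hwP => hindep b hb w hwP hw, hw⟩)
      (fun h => hb (Finset.mem_filter.1 h).1) hcb (fun h => hc (Finset.mem_filter.1 h).1)
    have heq := Finset.eq_of_subset_of_card_le (Finset.filter_subset (fun w => G.Adj b w) P)
      (by omega)
    rw [← heq] at ha
    exact (Finset.mem_filter.1 ha).2.symm
  · intro a ha b hb
    rw [Finset.mem_compl] at ha hb
    exact hindep a ha b hb
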